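/- arXiv:1312.2247 — 2 statements merged into one kernel-verified Lean document; each statement's English description precedes it below -/
import Mathlib

section
/- Let G be a connected bipartite k-regular finite simple graph with k ≥ 2. If k is odd and λ_2(G) < (k − 2 + √(k² + 8))/2, or if k is even and λ_2(G) < (k − 2 + √(k² + 12))/2, then t(G) = 1: every disconnecting set S of G satisfies |S| ≥ c(G − S), and there exists a disconnecting set S with |S| = c(G − S). -/
open SimpleGraph Matrix

/-- The list of adjacency-matrix eigenvalues of `G`, with multiplicity,
listed in decreasing order. -/
noncomputable def adjEigs {V : Type} [Fintype V] [DecidableEq V] (G : SimpleGraph V) :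
    List ℝ := by
  classical
  exact ((Finset.univ.val.map
      (Matrix.IsHermitian.eigenvalues
        (show (G.adjMatrix ℝ)ᴴ = G.adjMatrix ℝ by
          rw [Matrix.conjTranspose_eq_transpose_of_trivial]
          exact G.isSymm_adjMatrix))).sort (· ≤ ·)).reverse

/-- `adjEig G i` is the `i`-th largest adjacency eigenvalue of `G` (`1`-indexed),
so `adjEig G 1 = λ₁(G) ≥ adjEig G 2 = λ₂(G) ≥ ⋯`. -/
noncomputable def adjEig {V : Type} [Fintype V] [DecidableEq V] (G : SimpleGraph V) (i : ℕ) :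
    ℝ :=
  (adjEigs G).getD (i - 1) 0

/-- The number of connected components of `G − S`, the subgraph of `G` induced on the
complement of `S`. -/
noncomputable def numComp {V : Type} (G : SimpleGraph V) (S : Set V) : ℕ :=
  Nat.card (G.induce Sᶜ).ConnectedComponent

/-- `S` is an independent set of `G`. -/
def IsIndep {V : Type} (G : SimpleGraph V) (S : Set V) : Prop :=
  S.Pairwise fun u v => ¬ G.Adj u v

/-- The number of ordered adjacent pairs with first entry in `X` and second entry in `Y`. -/
def edgeCount {V : Type} (G : SimpleGraph V) [DecidableRel G.Adj] (X Y : Finset V) : ℕ :=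
  ∑ v ∈ X, ∑ w ∈ Y, if G.Adj v w then 1 else 0

section EdgeCount

variable {V : Type} (G : SimpleGraph V) [DecidableRel G.Adj]

lemma edgeCount_comm (X Y : Finset V) : edgeCount G X Y = edgeCount G Y X := by
  unfold edgeCount
  rw [Finset.sum_comm]
  simp only [G.adj_comm]

lemma edgeCount_union_right [DecidableEq V] {X Y Z : Finset V} (h : Disjoint Y Z) :
    edgeCount G X (Y ∪ Z) = edgeCount G X Y + edgeCount G X Z := by
  simp only [edgeCount, Finset.sum_union h, Finset.sum_add_distrib]

lemma edgeCount_union_left [DecidableEq V] {X Y Z : Finset V} (h : Disjoint X Y) :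
    edgeCount G (X ∪ Y) Z = edgeCount G X Z + edgeCount G Y Z := by
  simp only [edgeCount, Finset.sum_union h]

lemma edgeCount_eq_zero_iff {X Y : Finset V} :
    edgeCount G X Y = 0 ↔ ∀ v ∈ X, ∀ w ∈ Y, ¬ G.Adj v w := by
  simp [edgeCount, Finset.sum_eq_zero_iff]

lemma edgeCount_mono_right {X Y Z : Finset V} (h : Y ⊆ Z) :
    edgeCount G X Y ≤ edgeCount G X Z :=
  Finset.sum_le_sum fun _ _ => Finset.sum_le_sum_of_subset h

lemma edgeCount_le_card_mul_card (X Y : Finset V) : edgeCount G X Y ≤ X.card * Y.card := by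
  unfold edgeCount
  calc _ ≤ ∑ v ∈ X, ∑ w ∈ Y, 1 :=
        Finset.sum_le_sum fun _ _ => Finset.sum_le_sum fun _ _ => by split_ifs <;> simp
    _ = _ := by simp

lemma edgeCount_univ_right [Fintype V] {k : ℕ} (hreg : G.IsRegularOfDegree k) (X : Finset V) :
    edgeCount G X Finset.univ = k * X.card := by
  have h : ∀ v, (∑ w, if G.Adj v w then 1 else 0) = k := fun v => by
    rw [← hreg v, ← G.card_neighborFinset_eq_degree, G.neighborFinset_eq_filter,
      Finset.card_filter]
  simp [edgeCount, h, mul_comm]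

/-- If all neighbours of `X` lie in `Y`, every edge at `X` is counted by `edgeCount G X Y`. -/
lemma edgeCount_of_neighbors_subset [Fintype V] {k : ℕ} (hreg : G.IsRegularOfDegree k)
    {X Y : Finset V} (h : ∀ v ∈ X, ∀ w, G.Adj v w → w ∈ Y) :
    edgeCount G X Y = k * X.card := by
  rw [← edgeCount_univ_right G hreg X]
  refine Finset.sum_congr rfl fun v hv => Finset.sum_subset (Finset.subset_univ _) ?_
  intro w _ hw
  exact if_neg fun ha => hw (h v hv w ha)

/-- A union of components of `G - S` in a bipartite `k`-regular graph that sends fewer than `k`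
edges to `S` is balanced, has at least `k` vertices in each class, and sends the same number
of edges to `S` from each class. -/
lemma exists_balanced_of_edgeCount_lt [Fintype V] [DecidableEq V] {k : ℕ}
    (hreg : G.IsRegularOfDegree k) (col : G.Coloring (Fin 2)) {C S : Finset V}
    (hCS : Disjoint C S) (hne : C.Nonempty)
    (hnbr : ∀ v ∈ C, ∀ w, G.Adj v w → w ∈ C ∪ S) (hlt : edgeCount G C S < k) :
    ∃ x a : ℕ, 2 * x < k ∧ k ≤ a ∧ C.card = 2 * a ∧ edgeCount G C C + 2 * x = 2 * (k * a) := by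
  set P := C.filter (fun v => col v = 0) with hP
  set Q := C.filter (fun v => ¬ col v = 0) with hQ
  have hPQ : Disjoint P Q := Finset.disjoint_filter_filter_not _ _ _
  have hC : P ∪ Q = C := Finset.filter_union_filter_not_eq _ _
  have hPS : Disjoint P S := hCS.mono_left (Finset.filter_subset _ _)
  have hQS : Disjoint Q S := hCS.mono_left (Finset.filter_subset _ _)
  have hPP : edgeCount G P P = 0 := by
    rw [edgeCount_eq_zero_iff]
    intro v hv w hw ha
    have := col.valid ha
    simp only [hP, Finset.mem_filter] at hv hw
    exact this (hv.2.trans hw.2.symm)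
  have hQQ : edgeCount G Q Q = 0 := by
    rw [edgeCount_eq_zero_iff]
    intro v hv w hw ha
    have := col.valid ha
    simp only [hQ, Finset.mem_filter] at hv hw
    omega
  have e1 : edgeCount G P (C ∪ S) = k * P.card :=
    edgeCount_of_neighbors_subset G hreg fun v hv => hnbr v (Finset.filter_subset _ _ hv)
  have e2 : edgeCount G Q (C ∪ S) = k * Q.card :=
    edgeCount_of_neighbors_subset G hreg fun v hv => hnbr v (Finset.filter_subset _ _ hv)
  have e3 := edgeCount_union_left G (Z := S) hPQ
  have e4 := edgeCount_union_left G (Z := C) hPQ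
  have e5 := edgeCount_union_right G (X := P) hPQ
  have e6 := edgeCount_union_right G (X := Q) hPQ
  rw [hC] at e3 e4 e5 e6
  rw [edgeCount_union_right G hCS] at e1 e2
  have e7 := edgeCount_comm G Q P
  have e8 := edgeCount_le_card_mul_card G P Q
  have hcard := Finset.card_union_of_disjoint hPQ
  rw [hC] at hcard
  have hpos := hne.card_pos
  have hab : P.card = Q.card := by
    rcases lt_trichotomy P.card Q.card with h | h | h
    · have := Nat.mul_le_mul_left k (Nat.succ_le_of_lt h)
      rw [Nat.mul_succ] at this
      omega
    · exact h
    · have := Nat.mul_le_mul_left k (Nat.succ_le_of_lt h)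
      rw [Nat.mul_succ] at this
      omega
  rw [← hab] at e2 e8 hcard
  refine ⟨edgeCount G P S, P.card, by omega, ?_, by omega, by omega⟩
  by_contra! hka
  obtain ⟨b, rfl⟩ := Nat.exists_eq_add_of_lt hka
  have ha : 1 ≤ P.card := by omega
  have : edgeCount G P Q + edgeCount G P S = (P.card + b + 1) * P.card := by omega
  have hx : 2 * edgeCount G P S < P.card + b + 1 := by omega
  nlinarith [Nat.zero_le (b * (P.card - 1)), Nat.mul_le_mul_left b ha]

end EdgeCount

section SecondEigenvalue

/-- A decreasing list whose second entry is less than `d` has at most one entry `≥ d`. -/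
lemma countP_le_one_of_getD_lt {l : List ℝ} (hl : l.Pairwise (· ≥ ·)) {d : ℝ}
    (h : l.getD 1 0 < d) : l.countP (fun x => decide (d ≤ x)) ≤ 1 := by
  rcases l with _ | ⟨a, _ | ⟨b, t⟩⟩
  · simp
  · exact List.countP_le_length
  · have hb : b < d := by simpa using h
    have ht : (b :: t).countP (fun x => decide (d ≤ x)) = 0 := by
      rw [List.countP_eq_zero]
      intro x hx
      have hxb : x ≤ b := by
        rcases List.mem_cons.1 hx with rfl | hx
        · exact le_rfl
        · exact (List.pairwise_cons.1 (List.pairwise_cons.1 hl).2).1 x hx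
      simpa using hxb.trans_lt hb
    rw [List.countP_cons, ht]
    split_ifs <;> simp

lemma isHermitian_adjMatrix {V : Type} (G : SimpleGraph V) [DecidableRel G.Adj] :
    (G.adjMatrix ℝ).IsHermitian := by
  rw [Matrix.IsHermitian, Matrix.conjTranspose_eq_transpose_of_trivial]
  exact G.isSymm_adjMatrix

variable {V : Type} [Fintype V] [DecidableEq V] (G : SimpleGraph V) [DecidableRel G.Adj]

lemma adjEigs_eq : adjEigs G =
    ((Finset.univ.val.map (isHermitian_adjMatrix G).eigenvalues).sort (· ≤ ·)).reverse := by
  have heig : ∀ {A B : Matrix V V ℝ} (hA : A.IsHermitian) (hB : B.IsHermitian), A = B →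
      hA.eigenvalues = hB.eigenvalues := by
    rintro A _ hA hB rfl
    rfl
  unfold adjEigs
  congr!
  exact heig _ _ (by congr!)

/-- If `λ₂(G) < d`, all eigenvalues except possibly one (with multiplicity) are less than `d`. -/
lemma exists_eigenvalues_lt_of_adjEig_two_lt [Nonempty V] {d : ℝ} (h : adjEig G 2 < d) :
    ∃ i₀, ∀ i, i ≠ i₀ → (isHermitian_adjMatrix G).eigenvalues i < d := by
  have hsort : (adjEigs G).Pairwise (· ≥ ·) := by
    rw [adjEigs_eq, List.pairwise_reverse]
    exact Multiset.pairwise_sort _ _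
  have hcount := countP_le_one_of_getD_lt hsort h
  rw [adjEigs_eq, List.countP_reverse, ← Multiset.coe_countP, Multiset.sort_eq,
    Multiset.countP_map] at hcount
  have hcard : (Finset.univ.filter
      fun i => d ≤ (isHermitian_adjMatrix G).eigenvalues i).card ≤ 1 := by
    simpa [Finset.card, Finset.filter] using hcount
  rw [Finset.card_le_one] at hcard
  by_cases hex : ∃ i, d ≤ (isHermitian_adjMatrix G).eigenvalues i
  · obtain ⟨i₀, hi₀⟩ := hex
    refine ⟨i₀, fun i hi => ?_⟩
    by_contra! hd
    exact hi (hcard i (by simpa using hd) i₀ (by simpa using hi₀))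
  · push Not at hex
    exact ⟨Classical.arbitrary V, fun i _ => hex i⟩

/-- If `λ₂(G) < d`, the quadratic form of `A - d` is negative on a hyperplane. -/
lemma exists_dotProduct_adjMatrix_lt [Nonempty V] {d : ℝ} (h : adjEig G 2 < d) :
    ∃ u : V → ℝ, ∀ z : V → ℝ, z ≠ 0 → z ⬝ᵥ u = 0 →
      z ⬝ᵥ (G.adjMatrix ℝ *ᵥ z) < d * (z ⬝ᵥ z) := by
  obtain ⟨i₀, hi₀⟩ := exists_eigenvalues_lt_of_adjEig_two_lt G h
  set hA := isHermitian_adjMatrix G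
  set u : V → V → ℝ := fun i => (hA.eigenvectorBasis i).ofLp with hu
  have parseval : ∀ x y : V → ℝ, x ⬝ᵥ y = ∑ i, (x ⬝ᵥ u i) * (u i ⬝ᵥ y) := by
    intro x y
    have := hA.eigenvectorBasis.sum_inner_mul_inner (WithLp.toLp 2 x) (WithLp.toLp 2 y)
    simp only [EuclideanSpace.inner_eq_star_dotProduct, star_trivial] at this
    rw [dotProduct_comm x y, ← this]
    exact Finset.sum_congr rfl fun i _ => by
      rw [dotProduct_comm x, dotProduct_comm (u i) y]
  have heig : ∀ (i : V) (z : V → ℝ),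
      u i ⬝ᵥ (G.adjMatrix ℝ *ᵥ z) = hA.eigenvalues i * (z ⬝ᵥ u i) := by
    intro i z
    rw [dotProduct_mulVec, ← mulVec_transpose, G.isSymm_adjMatrix.eq]
    have := hA.mulVec_eigenvectorBasis i
    simp only [hu]
    rw [this, smul_dotProduct, smul_eq_mul, dotProduct_comm z]
  refine ⟨u i₀, fun z hz hzu => ?_⟩
  have hzz : z ⬝ᵥ z = ∑ i, (z ⬝ᵥ u i) ^ 2 := by
    rw [parseval z z]
    exact Finset.sum_congr rfl fun i _ => by rw [dotProduct_comm (u i) z, sq]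
  have hne : ∃ i, z ⬝ᵥ u i ≠ 0 := by
    by_contra! hall
    apply hz
    rw [← dotProduct_self_eq_zero, hzz]
    simp [hall]
  obtain ⟨j, hj⟩ := hne
  rw [parseval z, hzz, Finset.mul_sum]
  have hle : ∀ i, (z ⬝ᵥ u i) * (u i ⬝ᵥ (G.adjMatrix ℝ *ᵥ z)) ≤ d * (z ⬝ᵥ u i) ^ 2 := by
    intro i
    rw [heig]
    by_cases hi : i = i₀
    · simp [hi, hzu]
    · nlinarith [hi₀ i hi, sq_nonneg (z ⬝ᵥ u i)]
  refine Finset.sum_lt_sum (fun i _ => hle i) ⟨j, Finset.mem_univ _, ?_⟩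
  have hji : j ≠ i₀ := fun hji => hj (hji ▸ hzu)
  rw [heig]
  have : 0 < (z ⬝ᵥ u j) ^ 2 := by positivity
  nlinarith [hi₀ j hji]

lemma indicator_dotProduct_adjMatrix (X Y : Finset V) :
    (fun v => if v ∈ X then (1 : ℝ) else 0) ⬝ᵥ
      (G.adjMatrix ℝ *ᵥ fun v => if v ∈ Y then (1 : ℝ) else 0) = edgeCount G X Y := by
  simp only [dotProduct, mulVec, adjMatrix_apply, edgeCount, ite_mul, one_mul, zero_mul,
    mul_ite, mul_one, mul_zero, Finset.sum_ite_mem, Finset.univ_inter]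
  push_cast
  rfl

lemma indicator_dotProduct_indicator (X Y : Finset V) :
    (fun v => if v ∈ X then (1 : ℝ) else 0) ⬝ᵥ (fun v => if v ∈ Y then (1 : ℝ) else 0) =
      (X ∩ Y).card := by
  simp [dotProduct, ← ite_and, ← Finset.mem_inter, Finset.inter_comm]

/-- Two disjoint nonadjacent vertex sets of average internal degree at least `d` force
`λ₂(G) ≥ d`. -/
lemma le_adjEig_two {C D : Finset V} {d : ℝ} (hC : C.Nonempty) (hD : D.Nonempty)
    (hdisj : Disjoint C D) (hCD : ∀ v ∈ C, ∀ w ∈ D, ¬ G.Adj v w)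
    (hdC : d * C.card ≤ edgeCount G C C) (hdD : d * D.card ≤ edgeCount G D D) :
    d ≤ adjEig G 2 := by
  by_contra! hlt
  obtain ⟨c₀, hc₀⟩ := hC
  obtain ⟨d₀, hd₀⟩ := hD
  have : Nonempty V := ⟨c₀⟩
  obtain ⟨u, hu⟩ := exists_dotProduct_adjMatrix_lt G hlt
  set f : V → ℝ := fun v => if v ∈ C then 1 else 0 with hf
  set g : V → ℝ := fun v => if v ∈ D then 1 else 0 with hg
  obtain ⟨α, β, hαβ, hne⟩ : ∃ α β : ℝ, α * (f ⬝ᵥ u) + β * (g ⬝ᵥ u) = 0 ∧ (α ≠ 0 ∨ β ≠ 0) := by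
    by_cases h0 : f ⬝ᵥ u = 0
    · exact ⟨1, 0, by simp [h0], by simp⟩
    · exact ⟨g ⬝ᵥ u, -(f ⬝ᵥ u), by ring, Or.inr (neg_ne_zero.2 h0)⟩
  have hc₀D : c₀ ∉ D := Finset.disjoint_left.1 hdisj hc₀
  have hd₀C : d₀ ∉ C := Finset.disjoint_right.1 hdisj hd₀
  have hz : α • f + β • g ≠ 0 := by
    intro hz
    have h1 := congrFun hz c₀
    have h2 := congrFun hz d₀
    simp [hf, hg, hc₀, hc₀D] at h1
    simp [hf, hg, hd₀, hd₀C] at h2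
    tauto
  have key := hu (α • f + β • g) hz (by
    simpa only [add_dotProduct, smul_dotProduct, smul_eq_mul] using hαβ)
  have hCD0 : edgeCount G C D = 0 := (edgeCount_eq_zero_iff G).2 hCD
  have hDC0 : edgeCount G D C = 0 := edgeCount_comm G D C ▸ hCD0
  simp only [mulVec_add, mulVec_smul, add_dotProduct, dotProduct_add, smul_dotProduct,
    dotProduct_smul, smul_eq_mul, hf, hg, indicator_dotProduct_adjMatrix,
    indicator_dotProduct_indicator, hCD0, hDC0, Finset.inter_self,
    Finset.disjoint_iff_inter_eq_empty.1 hdisj,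
    Finset.disjoint_iff_inter_eq_empty.1 hdisj.symm, Finset.card_empty] at key
  push_cast at key
  nlinarith [mul_le_mul_of_nonneg_left hdC (sq_nonneg α),
    mul_le_mul_of_nonneg_left hdD (sq_nonneg β)]

end SecondEigenvalue

/-- Among more than `|S|` pairwise nonadjacent pieces of `G - S`, at least two send fewer than
`k` edges to `S`. -/
lemma exists_two_edgeCount_lt {V : Type} [Fintype V] [DecidableEq V] (G : SimpleGraph V)
    [DecidableRel G.Adj] {k : ℕ} (hreg : G.IsRegularOfDegree k) (hconn : G.Connected)
    {ι : Type} [Fintype ι] [DecidableEq ι] {S : Finset V} {C : ι → Finset V}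
    (hne : ∀ i, (C i).Nonempty) (hdisj : ∀ i j, i ≠ j → Disjoint (C i) (C j))
    (hnbr : ∀ i, ∀ v ∈ C i, ∀ w, G.Adj v w → w ∈ C i ∪ S)
    (hcard : S.card < Fintype.card ι) (htwo : 2 ≤ Fintype.card ι) :
    ∃ i j, i ≠ j ∧ edgeCount G (C i) S < k ∧ edgeCount G (C j) S < k := by
  have hpos : ∀ i, 0 < edgeCount G (C i) S := by
    intro i
    by_contra! h0
    rw [Nat.le_zero, edgeCount_eq_zero_iff] at h0
    have hclosed : ∀ v w, G.Adj v w → v ∈ C i → w ∈ C i := fun v w ha hv =>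
      (Finset.mem_union.1 (hnbr i v hv w ha)).resolve_right fun hw => h0 v hv w hw ha
    have hreach : ∀ v w, G.Walk v w → v ∈ C i → w ∈ C i := by
      intro v w p
      induction p with
      | nil => exact id
      | cons ha _ ih => exact fun hv => ih (hclosed _ _ ha hv)
    have : Nontrivial ι := Fintype.one_lt_card_iff_nontrivial.1 htwo
    obtain ⟨j, hj⟩ := exists_ne i
    obtain ⟨v, hv⟩ := hne i
    obtain ⟨w, hw⟩ := hne j
    obtain ⟨p⟩ := hconn.preconnected v w
    exact Finset.disjoint_left.1 (hdisj j i hj) hw (hreach v w p hv)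
  have htotal : ∑ i, edgeCount G (C i) S ≤ k * S.card := by
    calc ∑ i, edgeCount G (C i) S
        = edgeCount G (Finset.univ.biUnion C) S := by
          unfold edgeCount
          rw [Finset.sum_biUnion fun i _ j _ hij => hdisj i j hij]
      _ = edgeCount G S (Finset.univ.biUnion C) := edgeCount_comm G _ _
      _ ≤ edgeCount G S Finset.univ := edgeCount_mono_right G (Finset.subset_univ _)
      _ = k * S.card := edgeCount_univ_right G hreg S
  have hnonempty : Nonempty ι := Fintype.card_pos_iff.1 (by omega)
  have hex : ∀ i₀, ∃ j, j ≠ i₀ ∧ edgeCount G (C j) S < k := by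
    intro i₀
    by_contra! hall
    have h1 : ∑ _i ∈ Finset.univ.erase i₀, k ≤ ∑ i ∈ Finset.univ.erase i₀, edgeCount G (C i) S :=
      Finset.sum_le_sum fun i hi => hall i (Finset.ne_of_mem_erase hi)
    rw [Finset.sum_const, Finset.card_erase_of_mem (Finset.mem_univ _), Finset.card_univ,
      smul_eq_mul, mul_comm] at h1
    have h2 := Finset.add_sum_erase Finset.univ (fun i => edgeCount G (C i) S)
      (Finset.mem_univ i₀)
    have h3 : k * S.card ≤ k * (Fintype.card ι - 1) := Nat.mul_le_mul_left k (by omega)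
    have h4 := hpos i₀
    omega
  obtain ⟨i, -, hi⟩ := hex (Classical.arbitrary ι)
  obtain ⟨j, hji, hj⟩ := hex i
  exact ⟨i, j, hji.symm, hi, hj⟩

/-- The spectral threshold is at most the average internal degree guaranteed for a balanced
piece with at least `k` vertices in each class and `x` edges leaving each class. -/
lemma threshold_mul_le {k x a m c : ℕ} (hk : 2 ≤ k) (hka : k ≤ a) (hx : 2 * x + m ≤ k)
    (hmc : c = 4 * m + 4) (hm : m = 1 ∨ m = 2) :
    ((k : ℝ) - 2 + √((k : ℝ) ^ 2 + c)) / 2 * (2 * a : ℕ) ≤ 2 * (k * a) - 2 * x := by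
  have hk' : (2 : ℝ) ≤ k := by exact_mod_cast hk
  have hka' : (k : ℝ) ≤ a := by exact_mod_cast hka
  have hx' : 2 * (x : ℝ) + m ≤ k := by exact_mod_cast hx
  have hx0 : (0 : ℝ) ≤ x := x.cast_nonneg
  have hsqrt : √((k : ℝ) ^ 2 + c) ≤ k + 2 - (k - m) / k := by
    apply Real.sqrt_le_iff.2
    have hdiv : ((k : ℝ) - m) / k = 1 - m / k := by field_simp
    have hmk : (m : ℝ) / k * k = m := by field_simp
    have hm0 : 0 ≤ (m : ℝ) / k := by positivity
    rw [hdiv]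
    refine ⟨by linarith, ?_⟩
    subst hmc
    push_cast
    rcases hm with rfl | rfl
    · push_cast at *
      nlinarith
    · push_cast at *
      have ht : (2 : ℝ) / k ≤ 1 := (div_le_one (by linarith)).2 hk'
      nlinarith [mul_nonneg (sub_nonneg.2 hk') (sub_nonneg.2 ht),
        mul_nonneg (sub_nonneg.2 ht) (by linarith : (0 : ℝ) ≤ k - 1 - 2 / k)]
  have hxa : 2 * (x : ℝ) ≤ (k - m) / k * a := by
    have : (0 : ℝ) ≤ k - m := by linarith
    calc 2 * (x : ℝ) ≤ k - m := by linarith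
      _ = (k - m) / k * k := by field_simp
      _ ≤ (k - m) / k * a := by gcongr
  push_cast
  nlinarith [mul_le_mul_of_nonneg_right hsqrt (by linarith : (0 : ℝ) ≤ a)]

lemma numComp_le_ncard {V : Type} [Fintype V] [DecidableEq V]
    (G : SimpleGraph V) [DecidableRel G.Adj] (k : ℕ) (hk : 2 ≤ k)
    (hreg : G.IsRegularOfDegree k) (hconn : G.Connected) (hbip : G.Colorable 2)
    (hlam : (Odd k ∧ adjEig G 2 < ((k : ℝ) - 2 + Real.sqrt ((k : ℝ) ^ 2 + 8)) / 2) ∨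
            (Even k ∧ adjEig G 2 < ((k : ℝ) - 2 + Real.sqrt ((k : ℝ) ^ 2 + 12)) / 2))
    (S : Set V) (hS : 2 ≤ numComp G S) : numComp G S ≤ S.ncard := by
  classical
  obtain ⟨col⟩ := hbip
  by_contra! hlt
  let ι := (G.induce Sᶜ).ConnectedComponent
  have : Fintype ι := Fintype.ofFinite _
  let C : ι → Finset V := fun i =>
    Finset.univ.filter fun v => ∃ h : v ∈ Sᶜ, (G.induce Sᶜ).connectedComponentMk ⟨v, h⟩ = i
  have hmem : ∀ i v, v ∈ C i ↔
      ∃ h : v ∈ Sᶜ, (G.induce Sᶜ).connectedComponentMk ⟨v, h⟩ = i := fun i v => by simp [C]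
  have hne : ∀ i, (C i).Nonempty := by
    intro i
    induction i using SimpleGraph.ConnectedComponent.ind with
    | _ v => exact ⟨v, (hmem _ _).2 ⟨v.2, rfl⟩⟩
  have hdisj : ∀ i j, i ≠ j → Disjoint (C i) (C j) := by
    intro i j hij
    rw [Finset.disjoint_left]
    intro v hi hj
    obtain ⟨_, rfl⟩ := (hmem _ _).1 hi
    obtain ⟨_, rfl⟩ := (hmem _ _).1 hj
    exact hij rfl
  have hnbr : ∀ i, ∀ v ∈ C i, ∀ w, G.Adj v w → w ∈ C i ∪ S.toFinset := by
    intro i v hv w ha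
    obtain ⟨hvS, rfl⟩ := (hmem _ _).1 hv
    by_cases hw : w ∈ S
    · simp [hw]
    · refine Finset.mem_union_left _ ((hmem _ _).2 ⟨hw, ?_⟩)
      refine ConnectedComponent.sound (Adj.reachable ?_)
      simpa using ha.symm
  have hCS : ∀ i, Disjoint (C i) S.toFinset := by
    intro i
    rw [Finset.disjoint_left]
    intro v hv
    obtain ⟨hvS, -⟩ := (hmem _ _).1 hv
    simpa using hvS
  have hcardι : numComp G S = Fintype.card ι := Nat.card_eq_fintype_card
  rw [hcardι] at hS hlt
  rw [Set.ncard_eq_toFinset_card'] at hlt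
  obtain ⟨i, j, hij, hi, hj⟩ :=
    exists_two_edgeCount_lt G hreg hconn hne hdisj hnbr hlt hS
  have hnadj : ∀ v ∈ C i, ∀ w ∈ C j, ¬ G.Adj v w := by
    intro v hv w hw ha
    rcases Finset.mem_union.1 (hnbr i v hv w ha) with h | h
    · exact Finset.disjoint_left.1 (hdisj i j hij) h hw
    · exact Finset.disjoint_left.1 (hCS j) hw h
  have hdense : ∀ m c : ℕ, c = 4 * m + 4 → m = 1 ∨ m = 2 → (∀ x, 2 * x < k → 2 * x + m ≤ k) →
      ((k : ℝ) - 2 + √((k : ℝ) ^ 2 + c)) / 2 ≤ adjEig G 2 := by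
    intro m c hmc hm hpar
    have hpiece : ∀ l, edgeCount G (C l) S.toFinset < k →
        ((k : ℝ) - 2 + √((k : ℝ) ^ 2 + c)) / 2 * (C l).card ≤ edgeCount G (C l) (C l) := by
      intro l hl
      obtain ⟨x, a, hx, hka, hcard, hedge⟩ :=
        exists_balanced_of_edgeCount_lt G hreg col (hCS l) (hne l) (hnbr l) hl
      have hedge' : (edgeCount G (C l) (C l) : ℝ) + 2 * x = 2 * (k * a) := by
        exact_mod_cast hedge
      have := threshold_mul_le hk hka (hpar x hx) hmc hm
      rw [hcard]
      linarith
    exact le_adjEig_two G (hne i) (hne j) (hdisj i j hij) hnadj (hpiece i hi) (hpiece j hj)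
  rcases hlam with ⟨hodd, hlam⟩ | ⟨heven, hlam⟩
  · have := hdense 1 8 rfl (Or.inl rfl) fun x hx => by omega
    push_cast at this
    linarith
  · obtain ⟨r, rfl⟩ := heven
    have := hdense 2 12 rfl (Or.inr rfl) fun x hx => by omega
    push_cast at this hlam
    linarith

lemma numComp_eq_ncard_compl {V : Type} (G : SimpleGraph V) (S : Set V)
    (h : ∀ v ∉ S, ∀ w ∉ S, ¬ G.Adj v w) : numComp G S = Sᶜ.ncard := by
  have hbot : G.induce Sᶜ = ⊥ := by
    ext v w
    simpa using h v v.2 w w.2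
  rw [numComp, ← Nat.card_coe_set_eq]
  refine (Nat.card_congr (Equiv.ofBijective (G.induce Sᶜ).connectedComponentMk ⟨?_, ?_⟩)).symm
  · intro v w hvw
    have := ConnectedComponent.exact hvw
    rw [hbot] at this
    exact reachable_bot.1 this
  · intro c
    induction c using SimpleGraph.ConnectedComponent.ind with
    | _ v => exact ⟨v, rfl⟩

/-- In a bipartite `k`-regular graph with `k ≥ 2`, removing a colour class leaves as many
isolated vertices as were removed. -/
lemma exists_ncard_eq_numComp {V : Type} [Fintype V] [DecidableEq V]
    (G : SimpleGraph V) [DecidableRel G.Adj] (k : ℕ) (hk : 2 ≤ k)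
    (hreg : G.IsRegularOfDegree k) (hconn : G.Connected) (hbip : G.Colorable 2) :
    ∃ S : Set V, 2 ≤ numComp G S ∧ S.ncard = numComp G S := by
  classical
  obtain ⟨col⟩ := hbip
  set P : Finset V := Finset.univ.filter fun v => col v = 0 with hP
  have hPindep : ∀ v ∈ P, ∀ w, G.Adj v w → w ∈ Pᶜ := by
    intro v hv w ha
    have := col.valid ha
    simp only [hP, Finset.mem_filter, Finset.mem_univ, true_and, Finset.mem_compl] at hv ⊢
    exact fun hw => this (hv.trans hw.symm)
  have hQindep : ∀ v ∈ Pᶜ, ∀ w, G.Adj v w → w ∈ P := by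
    intro v hv w ha
    have := col.valid ha
    simp only [hP, Finset.mem_filter, Finset.mem_univ, true_and, Finset.mem_compl] at hv ⊢
    omega
  have h1 := edgeCount_of_neighbors_subset G hreg hPindep
  have h2 := edgeCount_of_neighbors_subset G hreg hQindep
  rw [edgeCount_comm, h1] at h2
  have hcard : P.card = Pᶜ.card := Nat.eq_of_mul_eq_mul_left (by omega) h2
  have hcomp : numComp G (P : Set V) = Pᶜ.card := by
    rw [numComp_eq_ncard_compl, ← Finset.coe_compl, Set.ncard_coe_finset]
    intro v hv w hw ha
    exact hw (hQindep v (by simpa using hv) w ha)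
  refine ⟨P, ?_, by rw [hcomp, Set.ncard_coe_finset, hcard]⟩
  rw [hcomp]
  obtain ⟨v⟩ := hconn.nonempty
  have hdeg : (G.neighborFinset v).card = k := hreg v
  by_cases hv : v ∈ P
  · have : G.neighborFinset v ⊆ Pᶜ := fun w hw => hPindep v hv w (by simpa using hw)
    have := Finset.card_le_card this
    omega
  · have : G.neighborFinset v ⊆ P := fun w hw =>
      hQindep v (Finset.mem_compl.2 hv) w (by simpa using hw)
    have := Finset.card_le_card this
    omega

/-- If `G` is a connected bipartite `k`-regular graph (`k ≥ 2`) with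
`λ₂(G) < (k − 2 + √(k² + 8))/2` when `k` is odd, or `λ₂(G) < (k − 2 + √(k² + 12))/2`
when `k` is even, then `t(G) = 1`: every disconnecting set `S` satisfies
`|S| ≥ c(G − S)`, and some disconnecting set `S` satisfies `|S| = c(G − S)`. -/
theorem bipartite_toughness_eq_one {V : Type} [Fintype V] [DecidableEq V]
    (G : SimpleGraph V) [DecidableRel G.Adj] (k : ℕ) (hk : 2 ≤ k)
    (hreg : G.IsRegularOfDegree k) (hconn : G.Connected) (hbip : G.Colorable 2)
    (hlam : (Odd k ∧ adjEig G 2 < ((k : ℝ) - 2 + Real.sqrt ((k : ℝ) ^ 2 + 8)) / 2) ∨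
            (Even k ∧ adjEig G 2 < ((k : ℝ) - 2 + Real.sqrt ((k : ℝ) ^ 2 + 12)) / 2)) :
    (∀ S : Set V, 2 ≤ numComp G S → numComp G S ≤ S.ncard) ∧
    ∃ S : Set V, 2 ≤ numComp G S ∧ S.ncard = numComp G S := by
  exact ⟨numComp_le_ncard G k hk hreg hconn hbip hlam,
    exists_ncard_eq_numComp G k hk hreg hconn hbip⟩
end

section
/- For every odd integer k ≥ 3 there exists a connected k-regular finite simple graph G on k² + 2k − 1 vertices with λ_2(G) = (k − 2 + √(k² + 8))/2 that admits a disconnecting set S of size k − 1 with c(G − S) = k; in particular t(G) ≤ (k−1)/k < 1. -/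
open SimpleGraph Matrix

/-! ### Spectral generalities -/

theorem adjEigs_eq_sort_roots_charpoly {V : Type} [Fintype V] [DecidableEq V]
    (G : SimpleGraph V) [hdec : DecidableRel G.Adj] :
    adjEigs G = ((G.adjMatrix ℝ).charpoly.roots.sort (· ≤ ·)).reverse := by
  have hA : (G.adjMatrix ℝ).IsHermitian := by
    rw [Matrix.IsHermitian, Matrix.conjTranspose_eq_transpose_of_trivial]
    exact G.isSymm_adjMatrix
  rw [hA.roots_charpoly_eq_eigenvalues]
  change adjEigs G = ((Finset.univ.val.map hA.eigenvalues).sort (· ≤ ·)).reverse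
  obtain rfl : hdec = fun v w => Classical.propDecidable (G.Adj v w) := Subsingleton.elim _ _
  rfl

theorem adjEig_eq_of_iso {V W : Type} [Fintype V] [DecidableEq V] [Fintype W] [DecidableEq W]
    {G : SimpleGraph V} {H : SimpleGraph W} (φ : G ≃g H) (i : ℕ) :
    adjEig G i = adjEig H i := by
  classical
  have hreindex : Matrix.reindex φ.toEquiv φ.toEquiv (G.adjMatrix ℝ) = H.adjMatrix ℝ := by
    ext v w
    have := φ.symm.map_adj_iff (v := v) (w := w)
    simp only [reindex_apply, submatrix_apply, SimpleGraph.adjMatrix_apply]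
    exact if_congr this rfl rfl
  rw [adjEig, adjEig, adjEigs_eq_sort_roots_charpoly, adjEigs_eq_sort_roots_charpoly, ← hreindex,
    Matrix.charpoly_reindex]

theorem Multiset.sort_reverse_cons_cons {a b : ℝ} {s : Multiset ℝ} (hab : b ≤ a)
    (hs : ∀ c ∈ s, c ≤ b) :
    ((a ::ₘ b ::ₘ s).sort (· ≤ ·)).reverse = a :: b :: (s.sort (· ≤ ·)).reverse := by
  rw [← List.reverse_inj, List.reverse_reverse]
  refine List.Perm.eq_of_pairwise' (r := (· ≤ ·)) (Multiset.pairwise_sort _ _) ?_ ?_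
  · simp only [List.reverse_cons, List.reverse_reverse, List.append_assoc, List.pairwise_append]
    refine ⟨Multiset.pairwise_sort _ _, by simpa using hab, fun c hc d hd => ?_⟩
    have := hs c (by simpa using hc)
    simp only [List.cons_append, List.nil_append, List.mem_cons, List.not_mem_nil,
      or_false] at hd
    rcases hd with rfl | rfl <;> linarith
  · rw [← Multiset.coe_eq_coe, Multiset.sort_eq, Multiset.coe_reverse, ← Multiset.cons_coe,
      ← Multiset.cons_coe, Multiset.coe_reverse, Multiset.sort_eq]

theorem Matrix.IsHermitian.exists_eigenvalues_eq {V : Type} [Fintype V] [DecidableEq V]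
    {A : Matrix V V ℝ} (hA : A.IsHermitian) {μ : ℝ} {x : V → ℝ} (hx : x ≠ 0)
    (h : A *ᵥ x = μ • x) : ∃ i, hA.eigenvalues i = μ := by
  have hμ : μ ∈ spectrum ℝ A := by
    rw [← Matrix.spectrum_toLin']
    exact (Module.End.hasEigenvalue_of_hasEigenvector (x := x)
      (Module.End.hasEigenvector_iff.2
        ⟨Module.End.mem_eigenspace_iff.2 (by simpa using h), hx⟩)).mem_spectrum
  rwa [hA.spectrum_real_eq_range_eigenvalues] at hμ

/-- If `d > θ` is an eigenvalue, every eigenvector for an eigenvalue above `θ` is constant, and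
`θ` is an eigenvalue, then `θ` is the second largest eigenvalue. -/
theorem adjEig_two_eq {V : Type} [Fintype V] [DecidableEq V]
    (G : SimpleGraph V) [DecidableRel G.Adj] {θ d : ℝ} (hθd : θ < d)
    (hd : ∃ x : V → ℝ, x ≠ 0 ∧ G.adjMatrix ℝ *ᵥ x = d • x)
    (hθ : ∃ x : V → ℝ, x ≠ 0 ∧ G.adjMatrix ℝ *ᵥ x = θ • x)
    (hconst : ∀ μ > θ, ∀ x : V → ℝ, G.adjMatrix ℝ *ᵥ x = μ • x → ∃ c, ∀ v, x v = c) :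
    adjEig G 2 = θ := by
  have hA : (G.adjMatrix ℝ).IsHermitian := by
    rw [Matrix.IsHermitian, Matrix.conjTranspose_eq_transpose_of_trivial]
    exact G.isSymm_adjMatrix
  obtain ⟨x, hx0, hx⟩ := hd
  obtain ⟨y, hy0, hy⟩ := hθ
  obtain ⟨i, hi⟩ := hA.exists_eigenvalues_eq hx0 hx
  obtain ⟨j, hj⟩ := hA.exists_eigenvalues_eq hy0 hy
  have hij : j ≠ i := by
    rintro rfl
    linarith
  have hle : ∀ l, l ≠ i → hA.eigenvalues l ≤ θ := by
    intro l hl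
    by_contra! hlt
    obtain ⟨a, ha⟩ := hconst _ hlt _ (hA.mulVec_eigenvectorBasis l)
    obtain ⟨b, hb⟩ := hconst _ (hi ▸ hθd) _ (hA.mulVec_eigenvectorBasis i)
    have horth := hA.eigenvectorBasis.orthonormal.2 hl
    have hnl := hA.eigenvectorBasis.orthonormal.1 l
    have hni := hA.eigenvectorBasis.orthonormal.1 i
    simp only [PiLp.inner_apply, ha, hb, EuclideanSpace.norm_eq] at horth hnl hni
    simp only [RCLike.inner_apply, conj_trivial, Finset.sum_const, nsmul_eq_mul, mul_eq_zero,
      Real.norm_eq_abs, sq_abs, Real.sqrt_eq_one] at horth hnl hni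
    rcases horth with h | h | h
    · rw [h] at hnl
      norm_num at hnl
    · rw [h] at hni
      norm_num at hni
    · rw [h] at hnl
      norm_num at hnl
  have hM : Finset.univ.val.map hA.eigenvalues =
      d ::ₘ θ ::ₘ ((Finset.univ.erase i).erase j).val.map hA.eigenvalues := by
    have hcons : (Finset.univ : Finset V).val =
        i ::ₘ j ::ₘ ((Finset.univ.erase i).erase j).val := by
      rw [← Finset.insert_val_of_notMem (by simp), Finset.insert_erase (by simp [hij]),
        ← Finset.insert_val_of_notMem (by simp), Finset.insert_erase (by simp)]
    rw [hcons, Multiset.map_cons, Multiset.map_cons, hi, hj]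
  rw [adjEig, adjEigs_eq_sort_roots_charpoly, hA.roots_charpoly_eq_eigenvalues]
  change ((Multiset.sort (Finset.univ.val.map hA.eigenvalues) (· ≤ ·)).reverse).getD 1 0 = θ
  rw [hM, Multiset.sort_reverse_cons_cons hθd.le]
  · simp
  · intro c hc
    obtain ⟨l, hl, rfl⟩ := Multiset.mem_map.1 hc
    exact hle l (Finset.ne_of_mem_erase (Finset.mem_of_mem_erase hl))

theorem numComp_image_of_iso {V W : Type} {G : SimpleGraph V} {H : SimpleGraph W} (φ : G ≃g H)
    (S : Set V) : numComp H (φ '' S) = numComp G S := by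
  refine (Nat.card_congr (SimpleGraph.Iso.connectedComponentEquiv
    (⟨φ.toEquiv.subtypeEquiv fun v => ?_, ?_⟩ : G.induce Sᶜ ≃g H.induce (φ '' S)ᶜ))).symm
  · simp
  · intro a b
    exact φ.map_adj_iff

/-! ### The extremal graph -/

/-- Adjacency in the extremal graph. A vertex is either a separator vertex `inl s`, or lies in one
of `2 * m + 1` blocks. A block is `K_{2m+2}` minus a perfect matching on `2 * m` of its vertices;
those are indexed by `s : Fin m × Bool` and joined to the separator vertex `s`. -/
def extremalAdj (m : ℕ) :
    (Fin m × Bool) ⊕ (Fin (2 * m + 1) × (Bool ⊕ (Fin m × Bool))) →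
    (Fin m × Bool) ⊕ (Fin (2 * m + 1) × (Bool ⊕ (Fin m × Bool))) → Prop
  | .inl _, .inl _ => False
  | .inl _, .inr (_, .inl _) => False
  | .inl s, .inr (_, .inr t) => s = t
  | .inr (_, .inl _), .inl _ => False
  | .inr (_, .inr s), .inl t => t = s
  | .inr (i, .inl a), .inr (j, .inl b) => i = j ∧ b = !a
  | .inr (i, .inl _), .inr (j, .inr _) => i = j
  | .inr (i, .inr _), .inr (j, .inl _) => i = j
  | .inr (i, .inr s), .inr (j, .inr t) => i = j ∧ s.1 ≠ t.1

/-- The extremal graph of degree `2 * m + 1`. -/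
def extremalGraph (m : ℕ) :
    SimpleGraph ((Fin m × Bool) ⊕ (Fin (2 * m + 1) × (Bool ⊕ (Fin m × Bool)))) where
  Adj := extremalAdj m
  symm := ⟨by
    rintro (s | ⟨i, a | s⟩) (t | ⟨j, b | t⟩) <;> simp only [extremalAdj] <;> aesop⟩
  loopless := ⟨by
    rintro (s | ⟨i, a | s⟩) <;> simp [extremalAdj]⟩

theorem extremalGraph_adj {m : ℕ}
    {v w : (Fin m × Bool) ⊕ (Fin (2 * m + 1) × (Bool ⊕ (Fin m × Bool)))} :
    (extremalGraph m).Adj v w ↔ extremalAdj m v w := Iff.rfl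

section Sums

variable {m : ℕ} [DecidableRel (extremalGraph m).Adj]
  (f : (Fin m × Bool) ⊕ (Fin (2 * m + 1) × (Bool ⊕ (Fin m × Bool))) → ℝ)

theorem extremalGraph_mulVec_separator (s : Fin m × Bool) :
    ((extremalGraph m).adjMatrix ℝ *ᵥ f) (.inl s) = ∑ i, f (.inr (i, .inr s)) := by
  simp [mulVec, dotProduct, adjMatrix_apply, extremalGraph_adj, extremalAdj,
    Fintype.sum_prod_type (α₁ := Fin (2 * m + 1))]

theorem extremalGraph_mulVec_universal (i : Fin (2 * m + 1)) (a : Bool) :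
    ((extremalGraph m).adjMatrix ℝ *ᵥ f) (.inr (i, .inl a)) =
      f (.inr (i, .inl (!a))) + ∑ s, f (.inr (i, .inr s)) := by
  simp [mulVec, dotProduct, adjMatrix_apply, extremalGraph_adj, extremalAdj,
    Fintype.sum_prod_type (α₁ := Fin (2 * m + 1)), -Fintype.univ_bool, ite_and,
    Finset.sum_add_distrib]

theorem extremalGraph_mulVec_matched (i : Fin (2 * m + 1)) (s : Fin m × Bool) :
    ((extremalGraph m).adjMatrix ℝ *ᵥ f) (.inr (i, .inr s)) =
      f (.inl s) + f (.inr (i, .inl true)) + f (.inr (i, .inl false))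
        + ∑ t, f (.inr (i, .inr t)) - f (.inr (i, .inr s)) - f (.inr (i, .inr (s.1, !s.2))) := by
  have hsplit (g : Fin m × Bool → ℝ) : (∑ t, if s.1 = t.1 then 0 else g t) =
      ∑ t, g t - g s - g (s.1, !s.2) := by
    have h : ∀ t, (if s.1 = t.1 then 0 else g t) = g t - if s.1 = t.1 then g t else 0 := by
      intro t
      split_ifs <;> simp
    obtain ⟨a, b⟩ := s
    simp only [h, Finset.sum_sub_distrib, sub_sub]
    cases b <;> simp [Fintype.sum_prod_type, Finset.sum_add_distrib, add_comm]
  simp [mulVec, dotProduct, adjMatrix_apply, extremalGraph_adj, extremalAdj,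
    Fintype.sum_prod_type (α₁ := Fin (2 * m + 1)), ite_and,
    Finset.sum_add_distrib, hsplit]
  ring

end Sums

theorem extremalGraph_mulVec_one {m : ℕ} [DecidableRel (extremalGraph m).Adj] :
    (extremalGraph m).adjMatrix ℝ *ᵥ (fun _ => 1) = (2 * m + 1 : ℝ) • fun _ => 1 := by
  funext v
  rcases v with s | ⟨i, a | s⟩
  · rw [extremalGraph_mulVec_separator]
    simp
  · rw [extremalGraph_mulVec_universal]
    simp
    ring
  · rw [extremalGraph_mulVec_matched]
    simp
    ring

theorem extremalGraph_ncard_neighborSet {m : ℕ}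
    (v : (Fin m × Bool) ⊕ (Fin (2 * m + 1) × (Bool ⊕ (Fin m × Bool)))) :
    ((extremalGraph m).neighborSet v).ncard = 2 * m + 1 := by
  classical
  have h := congrFun (extremalGraph_mulVec_one (m := m)) v
  rw [adjMatrix_mulVec_apply] at h
  simp only [Finset.sum_const, card_neighborFinset_eq_degree, nsmul_eq_mul, mul_one,
    Pi.smul_apply, smul_eq_mul] at h
  rw [← Nat.card_coe_set_eq, Nat.card_eq_fintype_card, card_neighborSet_eq_degree]
  exact_mod_cast h

theorem extremalGraph_exists_eigenvector {m : ℕ} (hm : 1 ≤ m) [DecidableRel (extremalGraph m).Adj]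
    {θ : ℝ} (hθ : θ ^ 2 - (2 * m - 1) * θ - (2 * m + 2) = 0) :
    ∃ x, x ≠ 0 ∧ (extremalGraph m).adjMatrix ℝ *ᵥ x = θ • x := by
  let i₀ : Fin (2 * m + 1) := ⟨0, by omega⟩
  let i₁ : Fin (2 * m + 1) := ⟨1, by omega⟩
  have hne : i₀ ≠ i₁ := by simp [i₀, i₁]
  let c : Fin (2 * m + 1) → ℝ := Pi.single i₀ 1 - Pi.single i₁ 1
  have hc : ∑ i, c i = 0 := by simp [c]
  let x : (Fin m × Bool) ⊕ (Fin (2 * m + 1) × (Bool ⊕ (Fin m × Bool))) → ℝ :=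
    Sum.elim 0 fun p => c p.1 * Sum.elim (fun _ => 2 * (m : ℝ)) (fun _ => θ - 1) p.2
  refine ⟨x, fun h => ?_, ?_⟩
  · have := congrFun h (.inr (i₀, .inl true))
    simp [x, c, hne] at this
    omega
  · funext v
    rcases v with s | ⟨i, a | s⟩
    · rw [extremalGraph_mulVec_separator]
      simp [x, ← Finset.sum_mul, hc]
    · rw [extremalGraph_mulVec_universal]
      simp [x]
      ring
    · rw [extremalGraph_mulVec_matched]
      simp [x]
      linear_combination (-c i) * hθ

theorem extremalGraph_eigenvector_const {m : ℕ} (hm : 1 ≤ m) [DecidableRel (extremalGraph m).Adj]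
    {μ : ℝ} (hμ : 2 * m < μ) (hp : 0 < μ ^ 2 - (2 * m - 1) * μ - (2 * m + 2))
    (f : (Fin m × Bool) ⊕ (Fin (2 * m + 1) × (Bool ⊕ (Fin m × Bool))) → ℝ)
    (hf : (extremalGraph m).adjMatrix ℝ *ᵥ f = μ • f) : ∃ c, ∀ v, f v = c := by
  have hm' : (1 : ℝ) ≤ m := by exact_mod_cast hm
  have hsep (s) : ∑ i, f (.inr (i, .inr s)) = μ * f (.inl s) := by
    rw [← extremalGraph_mulVec_separator, hf, Pi.smul_apply, smul_eq_mul]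
  have huniv (i a) : f (.inr (i, .inl (!a))) + ∑ s, f (.inr (i, .inr s)) =
      μ * f (.inr (i, .inl a)) := by
    rw [← extremalGraph_mulVec_universal, hf, Pi.smul_apply, smul_eq_mul]
  have hmat (i s) : f (.inl s) + f (.inr (i, .inl true)) + f (.inr (i, .inl false))
      + ∑ t, f (.inr (i, .inr t)) - f (.inr (i, .inr s)) - f (.inr (i, .inr (s.1, !s.2))) =
      μ * f (.inr (i, .inr s)) := by
    rw [← extremalGraph_mulVec_matched, hf, Pi.smul_apply, smul_eq_mul]
  -- The two universal vertices of a block carry the same value.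
  have hu (i) : f (.inr (i, .inl false)) = f (.inr (i, .inl true)) := by
    have h1 := huniv i true
    have h2 := huniv i false
    simp only [Bool.not_true, Bool.not_false] at h1 h2
    have : (μ + 1) * (f (.inr (i, .inl false)) - f (.inr (i, .inl true))) = 0 := by
      linear_combination h1 - h2
    rcases mul_eq_zero.1 this with h | h <;> linarith
  have hV (i) : ∑ s, f (.inr (i, .inr s)) = (μ - 1) * f (.inr (i, .inl true)) := by
    have h1 := huniv i true
    simp only [Bool.not_true, hu] at h1
    linear_combination h1
  have hflip (i) : ∑ s : Fin m × Bool, f (.inr (i, .inr (s.1, !s.2))) =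
      ∑ s, f (.inr (i, .inr s)) := by
    simp [Fintype.sum_prod_type, add_comm]
  -- The value on universal vertices does not depend on the block.
  obtain ⟨u, hu'⟩ : ∃ u, ∀ i, f (.inr (i, .inl true)) = u := by
    refine ⟨(∑ s, f (.inl s)) / (μ ^ 2 - (2 * m - 1) * μ - (2 * m + 2)), fun i => ?_⟩
    rw [eq_div_iff hp.ne']
    have h := Finset.sum_congr rfl fun s (_ : s ∈ Finset.univ) => hmat i s
    simp only [Finset.sum_sub_distrib, Finset.sum_add_distrib, ← Finset.mul_sum, hflip, hu, hV,
      Finset.sum_const, Finset.card_univ, Fintype.card_prod, Fintype.card_fin, Fintype.card_bool,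
      nsmul_eq_mul] at h
    push_cast at h
    linear_combination -h
  simp only [hV, hu, hu'] at hmat
  have hflipmat (i) (s : Fin m × Bool) := hmat i (s.1, !s.2)
  simp only [Bool.not_not, Prod.mk.eta] at hflipmat
  -- The value on matched vertices does not depend on the block.
  have hv (i j s) : f (.inr (i, .inr s)) = f (.inr (j, .inr s)) := by
    have hsum : (μ + 2) * ((f (.inr (i, .inr s)) - f (.inr (j, .inr s))) +
        (f (.inr (i, .inr (s.1, !s.2))) - f (.inr (j, .inr (s.1, !s.2))))) = 0 := by
      linear_combination -hmat i s + hmat j s - hflipmat i s + hflipmat j s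
    have hdiff : μ * ((f (.inr (i, .inr s)) - f (.inr (j, .inr s))) -
        (f (.inr (i, .inr (s.1, !s.2))) - f (.inr (j, .inr (s.1, !s.2))))) = 0 := by
      linear_combination -hmat i s + hmat j s + hflipmat i s - hflipmat j s
    rcases mul_eq_zero.1 hsum with h | h
    · linarith
    rcases mul_eq_zero.1 hdiff with h' | h' <;> linarith
  have hsep' (i s) : (2 * m + 1) * f (.inr (i, .inr s)) = μ * f (.inl s) := by
    rw [← hsep s, Finset.sum_congr rfl fun j _ => hv j i s]
    simp
  have hμsq : (2 * m + 1 : ℝ) < μ ^ 2 := by nlinarith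
  -- Partners carry the same value.
  have hpart (i s) : f (.inr (i, .inr (s.1, !s.2))) = f (.inr (i, .inr s)) := by
    have : (μ ^ 2 - (2 * m + 1)) *
        (f (.inr (i, .inr (s.1, !s.2))) - f (.inr (i, .inr s))) = 0 := by
      linear_combination μ * hmat i s - μ * hflipmat i s + hsep' i s - hsep' i (s.1, !s.2)
    rcases mul_eq_zero.1 this with h | h <;> linarith
  simp only [hpart] at hmat
  let i₀ : Fin (2 * m + 1) := 0
  obtain ⟨w, hw⟩ : ∃ w, ∀ i s, f (.inr (i, .inr s)) = w := by
    refine ⟨μ * (μ + 1) * u / (μ ^ 2 + 2 * μ - (2 * m + 1)), fun i s => ?_⟩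
    rw [eq_div_iff (by nlinarith)]
    linear_combination -μ * hmat i s - hsep' i s
  have hwu : 2 * m * w = (μ - 1) * u := by
    have := hV i₀
    simp only [hw, hu', Finset.sum_const, Finset.card_univ, Fintype.card_prod, Fintype.card_fin,
      Fintype.card_bool, nsmul_eq_mul] at this
    push_cast at this
    linear_combination this
  let s₀ : Fin m × Bool := (⟨0, hm⟩, true)
  have hx (s) : (2 * m + 1) * w = μ * f (.inl s) := by rw [← hsep' i₀ s, hw]
  have hcubic : (μ - (2 * m + 1)) * (μ ^ 2 + 2 * μ - 1) * w = 0 := by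
    have h := hmat i₀ s₀
    rw [hw] at h
    linear_combination -μ * (μ - 1) * h - (μ - 1) * hx s₀ - μ * (μ + 1) * hwu
  have hμ0 : μ ≠ 0 := by linarith
  have hμ1 : μ - 1 ≠ 0 := by linarith
  have hquad : μ ^ 2 + 2 * μ - 1 ≠ 0 := by nlinarith
  have hkey : μ * w = (2 * m + 1) * w := by
    rcases mul_eq_zero.1 hcubic with h | h
    · rcases mul_eq_zero.1 h with h | h
      · linear_combination w * h
      · exact absurd h hquad
    · simp [h]
  have huw : u = w := by
    refine mul_left_cancel₀ hμ1 ?_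
    linear_combination -hwu - hkey
  refine ⟨w, ?_⟩
  rintro (s | ⟨i, a | s⟩)
  · refine mul_left_cancel₀ hμ0 ?_
    linear_combination -hx s - hkey
  · cases a <;> simp [hu, hu', huw]
  · exact hw i s

theorem extremalGraph_adjEig_two {m : ℕ} (hm : 1 ≤ m) :
    adjEig (extremalGraph m) 2 = (2 * m - 1 + √((2 * m + 1) ^ 2 + 8)) / 2 := by
  classical
  have hm' : (1 : ℝ) ≤ m := by exact_mod_cast hm
  set r := √((2 * m + 1 : ℝ) ^ 2 + 8) with hr
  have hrsq : r ^ 2 = (2 * m + 1) ^ 2 + 8 := Real.sq_sqrt (by positivity)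
  have hlow : 2 * m + 1 < r := Real.lt_sqrt_of_sq_lt (by linarith)
  have hup : r < 2 * m + 3 := by
    rw [hr, Real.sqrt_lt' (by positivity)]
    nlinarith
  refine adjEig_two_eq _ (d := 2 * m + 1) (by linarith)
    ⟨fun _ => 1, fun h => ?_, extremalGraph_mulVec_one⟩
    (extremalGraph_exists_eigenvector hm ?_) fun μ hμ f hf =>
      extremalGraph_eigenvector_const hm (by linarith) ?_ f hf
  · simpa using congrFun h (.inl (⟨0, hm⟩, true))
  · linear_combination hrsq / 4
  · nlinarith

/-- The index of the block of a vertex, with a default value on the separator. -/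
def extremalBlock {m : ℕ} :
    (Fin m × Bool) ⊕ (Fin (2 * m + 1) × (Bool ⊕ (Fin m × Bool))) → Fin (2 * m + 1) :=
  Sum.elim (fun _ => 0) Prod.fst

theorem extremalBlock_eq_of_adj {m : ℕ}
    {v w : (Fin m × Bool) ⊕ (Fin (2 * m + 1) × (Bool ⊕ (Fin m × Bool)))}
    (hv : ∀ s, v ≠ .inl s) (hw : ∀ s, w ≠ .inl s) (h : (extremalGraph m).Adj v w) :
    extremalBlock v = extremalBlock w := by
  rw [extremalGraph_adj] at h
  rcases v with s | ⟨i, a | s⟩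
  · exact absurd rfl (hv s)
  all_goals
    rcases w with t | ⟨j, b | t⟩
    · exact absurd rfl (hw t)
    all_goals
      simp only [extremalAdj] at h
      simp only [extremalBlock, Sum.elim_inr, h]

theorem extremalGraph_numComp (m : ℕ) :
    numComp (extremalGraph m) (Set.range Sum.inl) = 2 * m + 1 := by
  have hmem (p : Fin (2 * m + 1) × (Bool ⊕ (Fin m × Bool))) :
      Sum.inr p ∈ (Set.range (Sum.inl : Fin m × Bool → _))ᶜ := by simp
  let H := (extremalGraph m).induce (Set.range Sum.inl)ᶜ
  let g : Fin (2 * m + 1) → H.ConnectedComponent := fun i =>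
    H.connectedComponentMk ⟨.inr (i, .inl true), hmem _⟩
  have hinv : ∀ a b, H.Reachable a b → extremalBlock a.1 = extremalBlock b.1 := by
    rintro a b ⟨p⟩
    induction p with
    | nil => rfl
    | @cons a b c h p ih =>
      rw [← ih]
      exact extremalBlock_eq_of_adj (fun s hs => a.2 ⟨s, hs.symm⟩) (fun s hs => b.2 ⟨s, hs.symm⟩) h
  have hg : Function.Bijective g := by
    constructor
    · intro i j h
      exact hinv _ _ (SimpleGraph.ConnectedComponent.exact h)
    · intro c
      induction c using SimpleGraph.ConnectedComponent.ind with | _ v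
      obtain ⟨s | ⟨i, x⟩, hv⟩ := v
      · simp at hv
      refine ⟨i, SimpleGraph.ConnectedComponent.sound ?_⟩
      rcases x with (_ | _) | s
      · exact SimpleGraph.Adj.reachable (by simp [H, extremalGraph_adj, extremalAdj])
      · exact SimpleGraph.Reachable.refl _
      · exact SimpleGraph.Adj.reachable (by simp [H, extremalGraph_adj, extremalAdj])
  rw [numComp, ← Nat.card_eq_of_bijective g hg, Nat.card_fin]

theorem extremalGraph_connected {m : ℕ} (hm : 1 ≤ m) : (extremalGraph m).Connected := by
  let s₀ : Fin m × Bool := (⟨0, hm⟩, true)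
  have hblock (i s) : (extremalGraph m).Reachable (.inr (i, .inr s)) (.inr (i, .inl true)) :=
    SimpleGraph.Adj.reachable (by simp [extremalGraph_adj, extremalAdj])
  have hsep (i s) : (extremalGraph m).Reachable (.inl s) (.inr (i, .inr s)) :=
    SimpleGraph.Adj.reachable (by simp [extremalGraph_adj, extremalAdj])
  have huniv (i) : (extremalGraph m).Reachable (.inr (i, .inl true)) (.inl s₀) :=
    (hblock i s₀).symm.trans (hsep i s₀).symm
  have hall (v) : (extremalGraph m).Reachable v (.inl s₀) := by
    rcases v with s | ⟨i, (_ | _) | s⟩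
    · exact ((hsep 0 s).trans (hblock 0 s)).trans (huniv 0)
    · refine (SimpleGraph.Adj.reachable ?_).trans (huniv i)
      simp [extremalGraph_adj, extremalAdj]
    · exact huniv i
    · exact (hblock i s).trans (huniv i)
  exact { preconnected := fun v w => (hall v).trans (hall w).symm, nonempty := ⟨.inl s₀⟩ }

/-- For every odd `k ≥ 3` there is a connected `k`-regular graph `G` on `k² + 2k − 1`
vertices with `λ₂(G) = (k − 2 + √(k² + 8))/2` admitting a disconnecting set `S` of size
`k − 1` with `c(G − S) = k`; in particular `t(G) ≤ (k − 1)/k < 1`. -/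
theorem exists_extremal_graph_odd (k : ℕ) (hk : 3 ≤ k) (hodd : Odd k) :
    ∃ G : SimpleGraph (Fin (k ^ 2 + 2 * k - 1)),
      G.Connected ∧ (∀ v, (G.neighborSet v).ncard = k) ∧
      adjEig G 2 = ((k : ℝ) - 2 + Real.sqrt ((k : ℝ) ^ 2 + 8)) / 2 ∧
      ∃ S : Set (Fin (k ^ 2 + 2 * k - 1)),
        S.ncard = k - 1 ∧ 2 ≤ numComp G S ∧ numComp G S = k := by
  obtain ⟨m, rfl⟩ := hodd
  have hm : 1 ≤ m := by omega
  have hcard : Fintype.card ((Fin m × Bool) ⊕ (Fin (2 * m + 1) × (Bool ⊕ (Fin m × Bool)))) =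
      (2 * m + 1) ^ 2 + 2 * (2 * m + 1) - 1 := by
    simp only [Fintype.card_sum, Fintype.card_prod, Fintype.card_fin, Fintype.card_bool]
    refine (Nat.sub_eq_of_eq_add ?_).symm
    ring
  let e := Fintype.equivFinOfCardEq hcard
  let φ : extremalGraph m ≃g (extremalGraph m).map e.toEmbedding := SimpleGraph.Iso.map e _
  refine ⟨(extremalGraph m).map e.toEmbedding, φ.connected_iff.1 (extremalGraph_connected hm),
    fun v => ?_, ?_, φ '' Set.range Sum.inl, ?_, ?_, ?_⟩
  · obtain ⟨w, rfl⟩ := φ.surjective v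
    rw [← Nat.card_coe_set_eq, ← Nat.card_congr (φ.mapNeighborSet w), Nat.card_coe_set_eq,
      extremalGraph_ncard_neighborSet]
  · rw [← adjEig_eq_of_iso φ, extremalGraph_adjEig_two hm]
    push_cast
    ring
  · rw [Set.ncard_image_of_injective _ φ.injective, ← Set.image_univ,
      Set.ncard_image_of_injective _ Sum.inl_injective, Set.ncard_univ]
    simp [mul_comm]
  · rw [numComp_image_of_iso, extremalGraph_numComp]
    omega
  · rw [numComp_image_of_iso, extremalGraph_numComp]
end
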